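/- arXiv:math/0003108 — 4 statements merged into one kernel-verified Lean document; each statement's English description precedes it below -/
import Mathlib

section
/- For Z = (α₁,β₁) and T = (α₂,β₂) in aff(R), let Z̃(p,q) = α₁p + β₁e^q and T̃(p,q) = α₂p + β₂e^q be the corresponding Hamiltonian functions on R² in the canonical Darboux coordinates (p,q). Then P^r(Z̃,T̃) = 0 for all r ≥ 2, so the Moyal ⋆-product series for Z̃ ⋆ T̃ is a finite sum, and the Moyal ⋆-product satisfies iZ̃ ⋆ iT̃ − iT̃ ⋆ iZ̃ = i·\widetilde{[Z,T]}, i.e. iZ̃ ⋆ iT̃ − iT̃ ⋆ iZ̃ = i(α₁β₂ − α₂β₁)e^q. -/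
noncomputable section

open Complex

/-- The standard basis vectors of `ℝ²` in the coordinates `x = (x¹,x²) = (p,q)`. -/
def basisR2 : Fin 2 → ℝ × ℝ := ![(1, 0), (0, 1)]

/-- The partial derivative of `f : ℝ² → ℂ` in the `i`-th coordinate direction. -/
def pd2 (i : Fin 2) (f : ℝ × ℝ → ℂ) : ℝ × ℝ → ℂ :=
  fun x => fderiv ℝ f x (basisR2 i)

/-- Iterated partial derivative `∂^r f / ∂x^{i₁}⋯∂x^{i_r}`. -/
def pd2Multi : (r : ℕ) → (Fin r → Fin 2) → (ℝ × ℝ → ℂ) → (ℝ × ℝ → ℂ)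
  | 0, _, f => f
  | r + 1, idx, f => pd2Multi r (fun k => idx k.succ) (pd2 (idx 0) f)

/-- The matrix `Λ` with `Λ¹² = 1`, `Λ²¹ = -1`, `Λ¹¹ = Λ²² = 0`. -/
def lambda2 : Fin 2 → Fin 2 → ℂ :=
  fun i j => !![0, 1; -1, 0] i j

/-- `P^r(u,v) = Σ Λ^{i₁j₁}⋯Λ^{i_rj_r} ∂_{i₁⋯i_r}u ∂_{j₁⋯j_r}v`. -/
def P2 (r : ℕ) (u v : ℝ × ℝ → ℂ) : ℝ × ℝ → ℂ := fun x =>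
  ∑ i : Fin r → Fin 2, ∑ j : Fin r → Fin 2,
    (∏ k : Fin r, lambda2 (i k) (j k)) * pd2Multi r i u x * pd2Multi r j v x

/-- The Moyal ⋆-product `u ⋆ v = uv + Σ_{r≥1} (1/r!)(1/(2i))^r P^r(u,v)`
(note that the `r = 0` term of the series is exactly `uv`). -/
def moyal2 (u v : ℝ × ℝ → ℂ) : ℝ × ℝ → ℂ := fun x =>
  ∑' r : ℕ, ((r.factorial : ℂ))⁻¹ * (1 / (2 * I)) ^ r * P2 r u v x

/-- The Hamiltonian function `Z̃(p,q) = αp + βe^q` of `Z = (α,β) ∈ aff(ℝ)`,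
viewed as complex valued. -/
def affHam (Z : ℝ × ℝ) : ℝ × ℝ → ℂ := fun x =>
  (Z.1 : ℂ) * (x.1 : ℂ) + (Z.2 : ℂ) * (Real.exp x.2 : ℂ)

theorem P2_succ (r : ℕ) (u v : ℝ × ℝ → ℂ) :
    P2 (r + 1) u v = P2 r (pd2 0 u) (pd2 1 v) - P2 r (pd2 1 u) (pd2 0 v) := by
  have sum_cons (F : (Fin (r + 1) → Fin 2) → ℂ) :
      ∑ i, F i = ∑ a : Fin 2, ∑ i : Fin r → Fin 2, F (Fin.cons a i) := by
    rw [← (Fin.consEquiv fun _ => Fin 2).sum_comp F, Fintype.sum_prod_type]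
    rfl
  funext x
  simp only [P2, Pi.sub_apply, sum_cons, Fin.prod_univ_succ, Fin.cons_zero, Fin.cons_succ,
    pd2Multi, Fin.sum_univ_two, Finset.sum_add_distrib]
  simp [lambda2, Finset.sum_neg_distrib, sub_eq_add_neg]
  exact add_comm _ _

theorem pd2_const (i : Fin 2) (c : ℂ) : pd2 i (fun _ => c) = fun _ => 0 := by
  funext x
  simp [pd2]

theorem P2_zero_left (r : ℕ) (v : ℝ × ℝ → ℂ) : P2 r (fun _ => 0) v = 0 := by
  induction r generalizing v with
  | zero => funext x; simp [P2, pd2Multi]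
  | succ r ih => simp [P2_succ, pd2_const, ih]

theorem P2_zero_right (r : ℕ) (u : ℝ × ℝ → ℂ) : P2 r u (fun _ => 0) = 0 := by
  induction r generalizing u with
  | zero => funext x; simp [P2, pd2Multi]
  | succ r ih => simp [P2_succ, pd2_const, ih]

theorem P2_succ_const_left (r : ℕ) (c : ℂ) (v : ℝ × ℝ → ℂ) :
    P2 (r + 1) (fun _ => c) v = 0 := by
  simp [P2_succ, pd2_const, P2_zero_left]

theorem P2_succ_const_right (r : ℕ) (c : ℂ) (u : ℝ × ℝ → ℂ) :
    P2 (r + 1) u (fun _ => c) = 0 := by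
  simp [P2_succ, pd2_const, P2_zero_right]

/-- The function `ap + be^q` with complex coefficients. -/
def complexAffHam (a b : ℂ) : ℝ × ℝ → ℂ := fun x => a * (x.1 : ℂ) + b * (Real.exp x.2 : ℂ)

theorem I_mul_affHam (Z : ℝ × ℝ) :
    (fun y => I * affHam Z y) = complexAffHam (I * Z.1) (I * Z.2) := by
  funext y
  simp only [affHam, complexAffHam]
  ring

theorem hasFDerivAt_complexAffHam (a b : ℂ) (x : ℝ × ℝ) :
    HasFDerivAt (complexAffHam a b)
      (a • ofRealCLM.comp (ContinuousLinearMap.fst ℝ ℝ ℝ) +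
        b • ofRealCLM.comp (Real.exp x.2 • ContinuousLinearMap.snd ℝ ℝ ℝ)) x :=
  ((ofRealCLM.hasFDerivAt.comp x hasFDerivAt_fst).const_mul a).add
    ((ofRealCLM.hasFDerivAt.comp x hasFDerivAt_snd.exp).const_mul b)

theorem pd2_zero_complexAffHam (a b : ℂ) : pd2 0 (complexAffHam a b) = fun _ => a := by
  funext x
  simp [pd2, (hasFDerivAt_complexAffHam a b x).fderiv, basisR2]

theorem pd2_one_complexAffHam (a b : ℂ) :
    pd2 1 (complexAffHam a b) = fun x => b * (Real.exp x.2 : ℂ) := by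
  funext x
  simp [pd2, (hasFDerivAt_complexAffHam a b x).fderiv, basisR2]

theorem P2_complexAffHam_eq_zero (a b c d : ℂ) {r : ℕ} (hr : 2 ≤ r) :
    P2 r (complexAffHam a b) (complexAffHam c d) = 0 := by
  obtain ⟨r, rfl⟩ := Nat.exists_eq_add_of_le' hr
  rw [P2_succ, pd2_zero_complexAffHam, pd2_zero_complexAffHam, P2_succ_const_left,
    P2_succ_const_right, sub_zero]

theorem moyal2_complexAffHam (a b c d : ℂ) (x : ℝ × ℝ) :
    moyal2 (complexAffHam a b) (complexAffHam c d) x =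
      complexAffHam a b x * complexAffHam c d x +
        1 / (2 * I) * ((a * d - b * c) * (Real.exp x.2 : ℂ)) := by
  rw [moyal2, tsum_eq_sum (s := Finset.range 2), Finset.sum_range_succ, Finset.sum_range_one,
    P2_succ, pd2_zero_complexAffHam, pd2_zero_complexAffHam, pd2_one_complexAffHam,
    pd2_one_complexAffHam]
  · simp [P2, pd2Multi]
    ring
  · intro r hr
    rw [P2_complexAffHam_eq_zero a b c d (not_lt.mp (mt Finset.mem_range.mpr hr)), Pi.zero_apply, mul_zero]

/-- For `Z = (α₁,β₁)`, `T = (α₂,β₂)` in `aff(ℝ)`: `P^r(Z̃,T̃) = 0` for all `r ≥ 2`,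
and the Moyal ⋆-product satisfies `iZ̃ ⋆ iT̃ - iT̃ ⋆ iZ̃ = i(α₁β₂ - α₂β₁)e^q`,
i.e. `iZ̃ ⋆ iT̃ - iT̃ ⋆ iZ̃ = i ⋅ \widetilde{[Z,T]}`. -/
theorem moyal_bracket_affR (Z T : ℝ × ℝ) :
    (∀ r : ℕ, 2 ≤ r → P2 r (affHam Z) (affHam T) = 0) ∧
    (∀ x : ℝ × ℝ,
      moyal2 (fun y => I * affHam Z y) (fun y => I * affHam T y) x -
        moyal2 (fun y => I * affHam T y) (fun y => I * affHam Z y) x =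
      I * ((Z.1 : ℂ) * (T.2 : ℂ) - (T.1 : ℂ) * (Z.2 : ℂ)) * (Real.exp x.2 : ℂ)) := by
  refine ⟨fun r hr => P2_complexAffHam_eq_zero _ _ _ _ hr, fun x => ?_⟩
  rw [I_mul_affHam, I_mul_affHam, moyal2_complexAffHam, moyal2_complexAffHam]
  field_simp
  ring

end
end

section
/- For A = (α,β) and B = (α',β') in aff(C), let Ã(z,w) = (1/2)(αz + βe^w + ᾱz̄ + β̄e^{w̄}) and B̃(z,w) = (1/2)(α'z + β'e^w + ᾱ'z̄ + β̄'e^{w̄}) be the corresponding Hamiltonian functions on R⁴ (z = p₁+ip₂, w = q₁+iq₂). Then P^r(Ã,B̃) = 0 for all r ≥ 2, so the Moyal ⋆-product series for Ã ⋆ B̃ is a finite sum, and iÃ ⋆ iB̃ − iB̃ ⋆ iÃ = i·\widetilde{[A,B]}, i.e. iÃ ⋆ iB̃ − iB̃ ⋆ iÃ = (i/2)((αβ'−α'β)e^w + \overline{(αβ'−α'β)}e^{w̄}). -/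
noncomputable section

open Complex

/-- `ℝ⁴` with coordinates `(x¹,x²,x³,x⁴) = (p₁,q₁,p₂,q₂)`. -/
abbrev R4 := Fin 4 → ℝ

/-- The complex coordinate `z = p₁ + ip₂` of a point of `ℝ⁴`. -/
def zOf (x : R4) : ℂ := (x 0 : ℂ) + I * (x 2 : ℂ)

/-- The complex coordinate `w = q₁ + iq₂` of a point of `ℝ⁴`. -/
def wOf (x : R4) : ℂ := (x 1 : ℂ) + I * (x 3 : ℂ)

/-- The partial derivative of `f : ℝ⁴ → ℂ` in the `i`-th coordinate direction. -/
def pd4 (i : Fin 4) (f : R4 → ℂ) : R4 → ℂ :=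
  fun x => fderiv ℝ f x (Pi.single i 1)

/-- Iterated partial derivative `∂^r f / ∂x^{i₁}⋯∂x^{i_r}`. -/
def pd4Multi : (r : ℕ) → (Fin r → Fin 4) → (R4 → ℂ) → (R4 → ℂ)
  | 0, _, f => f
  | r + 1, idx, f => pd4Multi r (fun k => idx k.succ) (pd4 (idx 0) f)

/-- The matrix `Λ` with nonzero entries `Λ¹² = 1`, `Λ²¹ = -1`, `Λ³⁴ = -1`,
`Λ⁴³ = 1`. -/
def lambda4 : Fin 4 → Fin 4 → ℂ :=
  fun i j => !![0, 1, 0, 0; -1, 0, 0, 0; 0, 0, 0, -1; 0, 0, 1, 0] i j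

/-- `P^r(u,v) = Σ Λ^{i₁j₁}⋯Λ^{i_rj_r} ∂_{i₁⋯i_r}u ∂_{j₁⋯j_r}v`. -/
def P4 (r : ℕ) (u v : R4 → ℂ) : R4 → ℂ := fun x =>
  ∑ i : Fin r → Fin 4, ∑ j : Fin r → Fin 4,
    (∏ k : Fin r, lambda4 (i k) (j k)) * pd4Multi r i u x * pd4Multi r j v x

/-- The Moyal ⋆-product `u ⋆ v = uv + Σ_{r≥1} (1/r!)(1/(2i))^r P^r(u,v)`
(the `r = 0` term of the series is exactly `uv`). -/
def moyal4 (u v : R4 → ℂ) : R4 → ℂ := fun x =>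
  ∑' r : ℕ, ((r.factorial : ℂ))⁻¹ * (1 / (2 * I)) ^ r * P4 r u v x

/-- The Hamiltonian function `Ã(z,w) = (1/2)(αz + βe^w + ᾱz̄ + β̄e^{w̄})` of
`A = (α,β) ∈ aff(ℂ)`, in the coordinates `(p₁,q₁,p₂,q₂)` of `ℝ⁴`. -/
def affHamC4 (A : ℂ × ℂ) : R4 → ℂ := fun x =>
  (1 / 2) * (A.1 * zOf x + A.2 * Complex.exp (wOf x) +
    (starRingEnd ℂ) A.1 * (starRingEnd ℂ) (zOf x) +
    (starRingEnd ℂ) A.2 * Complex.exp ((starRingEnd ℂ) (wOf x)))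

/-- The complex-valued real-linear form `p x i + q x j` on `ℝ⁴`. -/
def coordForm (i j : Fin 4) (q : ℂ) : R4 →L[ℝ] ℂ :=
  ofRealCLM.comp (ContinuousLinearMap.proj i) + q • ofRealCLM.comp (ContinuousLinearMap.proj j)

/-- The function `k + az + be^w + cz̄ + de^{w̄}` on `ℝ⁴`. -/
def affExp (k a b c d : ℂ) : R4 → ℂ := fun x =>
  k + a * coordForm 0 2 I x + b * Complex.exp (coordForm 1 3 I x) +
    c * coordForm 0 2 (-I) x + d * Complex.exp (coordForm 1 3 (-I) x)

lemma affHamC4_eq_affExp (A : ℂ × ℂ) :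
    affHamC4 A = affExp 0 (A.1 / 2) (A.2 / 2) ((starRingEnd ℂ) A.1 / 2)
      ((starRingEnd ℂ) A.2 / 2) := by
  funext x
  simp [affHamC4, affExp, coordForm, zOf, wOf]
  ring

lemma const_mul_affExp (t k a b c d : ℂ) :
    (fun y => t * affExp k a b c d y) = affExp (t * k) (t * a) (t * b) (t * c) (t * d) := by
  funext x
  simp only [affExp]
  ring

lemma pd4_affExp (i : Fin 4) (k a b c d : ℂ) (x : R4) :
    pd4 i (affExp k a b c d) x =
      a * coordForm 0 2 I (Pi.single i 1) +
      b * (Complex.exp (coordForm 1 3 I x) * coordForm 1 3 I (Pi.single i 1)) +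
      c * coordForm 0 2 (-I) (Pi.single i 1) +
      d * (Complex.exp (coordForm 1 3 (-I) x) * coordForm 1 3 (-I) (Pi.single i 1)) := by
  have hz := (coordForm 0 2 I).hasFDerivAt (x := x)
  have hw := (coordForm 1 3 I).hasFDerivAt (x := x)
  have hz' := (coordForm 0 2 (-I)).hasFDerivAt (x := x)
  have hw' := (coordForm 1 3 (-I)).hasFDerivAt (x := x)
  have h := (((((hasFDerivAt_const k x).add (hz.const_mul a)).add (hw.cexp.const_mul b)).add
    (hz'.const_mul c)).add (hw'.cexp.const_mul d)).fderiv
  change fderiv ℝ (affExp k a b c d) x = _ at h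
  simp [pd4, h]

lemma pd4_zero_affExp (k a b c d : ℂ) :
    pd4 0 (affExp k a b c d) = affExp (a + c) 0 0 0 0 := by
  funext x
  simp [pd4_affExp, affExp, coordForm]

lemma pd4_one_affExp (k a b c d : ℂ) :
    pd4 1 (affExp k a b c d) = affExp 0 0 b 0 d := by
  funext x
  simp [pd4_affExp, affExp, coordForm]

lemma pd4_two_affExp (k a b c d : ℂ) :
    pd4 2 (affExp k a b c d) = affExp (I * (a - c)) 0 0 0 0 := by
  funext x
  simp [pd4_affExp, affExp, coordForm]
  ring

lemma pd4_three_affExp (k a b c d : ℂ) :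
    pd4 3 (affExp k a b c d) = affExp 0 0 (I * b) 0 (-I * d) := by
  funext x
  simp [pd4_affExp, affExp, coordForm]
  ring

lemma affExp_zero : affExp 0 0 0 0 0 = 0 := by
  funext x
  simp [affExp]

lemma pd4Multi_zero (r : ℕ) (i : Fin r → Fin 4) : pd4Multi r i 0 = 0 := by
  induction r with
  | zero => rfl
  | succ r ih =>
    have h : pd4 (i 0) 0 = 0 := by
      funext x
      simp [pd4]
    rw [pd4Multi, h, ih]

lemma pd4_pd4_affExp {i j : Fin 4} (h : i = 0 ∨ i = 2 ∨ j = 0 ∨ j = 2) (k a b c d : ℂ) :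
    pd4 j (pd4 i (affExp k a b c d)) = 0 := by
  fin_cases i <;> fin_cases j <;>
    simp_all [pd4_zero_affExp, pd4_one_affExp, pd4_two_affExp, pd4_three_affExp, affExp_zero]

lemma pd4Multi_affExp {r : ℕ} {i : Fin (r + 2) → Fin 4}
    (h : i 0 = 0 ∨ i 0 = 2 ∨ i 1 = 0 ∨ i 1 = 2) (k a b c d : ℂ) :
    pd4Multi (r + 2) i (affExp k a b c d) = 0 := by
  have h' : pd4 (i (Fin.succ 0)) (pd4 (i 0) (affExp k a b c d)) = 0 :=
    pd4_pd4_affExp h k a b c d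
  rw [pd4Multi, pd4Multi, h', pd4Multi_zero]

/-- `Λ` only pairs momenta with positions. -/
lemma lambda4_ne_zero {i j : Fin 4} (h : lambda4 i j ≠ 0) :
    (i = 0 ∨ i = 2) ∨ (j = 0 ∨ j = 2) := by
  fin_cases i <;> fin_cases j <;> simp_all [lambda4]

lemma P4_affExp_eq_zero {r : ℕ} (hr : 2 ≤ r) (k a b c d k' a' b' c' d' : ℂ) :
    P4 r (affExp k a b c d) (affExp k' a' b' c' d') = 0 := by
  obtain ⟨r, rfl⟩ := Nat.exists_eq_add_of_le' hr
  funext x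
  refine Finset.sum_eq_zero fun i _ => Finset.sum_eq_zero fun j _ => ?_
  by_cases hi : i 0 = 0 ∨ i 0 = 2 ∨ i 1 = 0 ∨ i 1 = 2
  · simp [pd4Multi_affExp hi]
  by_cases hj : j 0 = 0 ∨ j 0 = 2 ∨ j 1 = 0 ∨ j 1 = 2
  · simp [pd4Multi_affExp hj]
  have h : lambda4 (i 0) (j 0) = 0 := by
    by_contra h
    rcases lambda4_ne_zero h with h | h <;> tauto
  rw [Finset.prod_eq_zero (Finset.mem_univ 0) h]
  simp

lemma P4_zero_apply (u v : R4 → ℂ) (x : R4) : P4 0 u v x = u x * v x := by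
  simp [P4, pd4Multi]

lemma P4_one_apply (u v : R4 → ℂ) (x : R4) :
    P4 1 u v x = pd4 0 u x * pd4 1 v x - pd4 1 u x * pd4 0 v x -
      pd4 2 u x * pd4 3 v x + pd4 3 u x * pd4 2 v x := by
  simp only [P4, ← (Equiv.funUnique (Fin 1) (Fin 4)).symm.sum_comp]
  simp [Fin.sum_univ_four, pd4Multi, lambda4]
  ring

lemma moyal4_affExp (k a b c d k' a' b' c' d' : ℂ) (x : R4) :
    moyal4 (affExp k a b c d) (affExp k' a' b' c' d') x =
      affExp k a b c d x * affExp k' a' b' c' d' x +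
        1 / (2 * I) * P4 1 (affExp k a b c d) (affExp k' a' b' c' d') x := by
  rw [moyal4, tsum_eq_sum (s := Finset.range 2)]
  · simp [Finset.sum_range_succ, P4_zero_apply]
  · intro r hr
    simp [P4_affExp_eq_zero (not_lt.mp (mt Finset.mem_range.mpr hr))]

/-- For `A = (α,β)`, `B = (α',β')` in `aff(ℂ)`: `P^r(Ã,B̃) = 0` for all `r ≥ 2`,
so the Moyal series for `Ã ⋆ B̃` is a finite sum, and
`iÃ ⋆ iB̃ - iB̃ ⋆ iÃ = i·\widetilde{[A,B]}
  = (i/2)((αβ'-α'β)e^w + conj(αβ'-α'β)e^{w̄})`. -/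
theorem moyal_bracket_affC (A B : ℂ × ℂ) :
    (∀ r : ℕ, 2 ≤ r → P4 r (affHamC4 A) (affHamC4 B) = 0) ∧
    (∀ x : R4,
      moyal4 (fun y => I * affHamC4 A y) (fun y => I * affHamC4 B y) x -
        moyal4 (fun y => I * affHamC4 B y) (fun y => I * affHamC4 A y) x =
      (I / 2) * ((A.1 * B.2 - B.1 * A.2) * Complex.exp (wOf x) +
        (starRingEnd ℂ) (A.1 * B.2 - B.1 * A.2) *
          Complex.exp ((starRingEnd ℂ) (wOf x)))) := by
  refine ⟨fun r hr => ?_, fun x => ?_⟩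
  · simp only [affHamC4_eq_affExp, P4_affExp_eq_zero hr]
  · have hw : coordForm 1 3 I x = wOf x := by simp [coordForm, wOf]
    have hw' : coordForm 1 3 (-I) x = (starRingEnd ℂ) (wOf x) := by simp [coordForm, wOf]
    simp only [affHamC4_eq_affExp, const_mul_affExp, moyal4_affExp, P4_one_apply,
      pd4_zero_affExp, pd4_one_affExp, pd4_two_affExp, pd4_three_affExp]
    simp only [affExp, hw, hw', one_div, mul_inv, inv_I, map_sub, map_mul]
    ring_nf
    simp only [I_pow_three, show I ^ 5 = I by rw [pow_succ, I_pow_four, one_mul]]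
    ring

end
end

section
/- Let A = (α,β) ∈ aff(C) with Hamiltonian function Ã(z,w) = (1/2)(αz + βe^w + ᾱz̄ + β̄e^{w̄}), let f be a compactly supported smooth function of (ξ,w) ∈ C × C, and set g = F_z⁻¹(f). Then for every integer r ≥ 2: F_z(P^r(Ã,g))(ξ,w) = (−1)^r 2^{r−1} [β̄ e^{w̄} (iξ/2)^r + β e^w (iξ̄/2)^r] f(ξ,w). -/
noncomputable section

open Complex MeasureTheory

/-- View a function of the complex coordinates `(z,w)` as a function on `ℝ⁴`. -/
def toCoords (h : ℂ × ℂ → ℂ) : R4 → ℂ := fun x => h (zOf x, wOf x)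

/-- View a function on `ℝ⁴` as a function of the complex coordinates `(z,w)`. -/
def ofCoords (u : R4 → ℂ) : ℂ × ℂ → ℂ := fun p =>
  u ![p.1.re, p.2.re, p.1.im, p.2.im]

/-- The partial Fourier transform in `z = p₁ + ip₂`:
`F_z(f)(ξ,w) = (1/(2π)) ∫_{ℝ²} e^{-i Re(ξ z̄)} f(z,w) dp₁dp₂`. -/
def Fz (f : ℂ × ℂ → ℂ) : ℂ × ℂ → ℂ := fun p =>
  (1 / (2 * Real.pi) : ℝ) •
    ∫ t : ℝ × ℝ,
      Complex.exp (-(Complex.I * ((p.1 * (starRingEnd ℂ) ((t.1 : ℂ) + Complex.I * (t.2 : ℂ))).re : ℂ))) *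
        f ((t.1 : ℂ) + Complex.I * (t.2 : ℂ), p.2)

/-- The inverse partial Fourier transform:
`F_z⁻¹(f)(z,w) = (1/(2π)) ∫_{ℝ²} e^{i Re(ξ z̄)} f(ξ,w) dξ₁dξ₂`. -/
def FzInv (f : ℂ × ℂ → ℂ) : ℂ × ℂ → ℂ := fun p =>
  (1 / (2 * Real.pi) : ℝ) •
    ∫ t : ℝ × ℝ,
      Complex.exp (Complex.I * (((((t.1 : ℂ) + Complex.I * (t.2 : ℂ)) * (starRingEnd ℂ) p.1).re : ℂ))) *
        f ((t.1 : ℂ) + Complex.I * (t.2 : ℂ), p.2)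

section Auxiliary

open scoped ComplexConjugate FourierTransform

/-- Differentiation under the integral sign for a `C¹` integrand whose support in the integration
variable lies in a fixed compact set. -/
theorem hasFDerivAt_integral_of_contDiff_of_isCompact {H V E : Type*}
    [NormedAddCommGroup H] [NormedSpace ℝ H] [ProperSpace H]
    [NormedAddCommGroup V] [NormedSpace ℝ V] [SecondCountableTopology V]
    [MeasurableSpace V] [BorelSpace V]
    [NormedAddCommGroup E] [NormedSpace ℝ E]
    {μ : Measure V} [IsFiniteMeasureOnCompacts μ]
    {F : H → V → E} (hF : ContDiff ℝ 1 (Function.uncurry F)) {K : Set V} (hK : IsCompact K)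
    (hFK : ∀ x, ∀ v ∉ K, F x v = 0) (x₀ : H) :
    Integrable (fun v => fderiv ℝ (F · v) x₀) μ ∧
      HasFDerivAt (fun x => ∫ v, F x v ∂μ) (∫ v, fderiv ℝ (F · v) x₀ ∂μ) x₀ := by
  have hd : ∀ x v, HasFDerivAt (F · v)
      ((fderiv ℝ (Function.uncurry F) (x, v)).comp (ContinuousLinearMap.inl ℝ H V)) x := by
    intro x v
    have h1 := (hF.differentiable one_ne_zero (x, v)).hasFDerivAt
    exact HasFDerivAt.comp (f := fun y => (y, v)) x h1 (hasFDerivAt_prodMk_left x v)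
  have hcont : Continuous (fun q : H × V => fderiv ℝ (F · q.2) q.1) := by
    have h1 : (fun q : H × V => fderiv ℝ (F · q.2) q.1) = fun q =>
        (fderiv ℝ (Function.uncurry F) q).comp (ContinuousLinearMap.inl ℝ H V) := by
      ext1 q
      exact (hd q.1 q.2).fderiv
    rw [h1]
    exact (hF.continuous_fderiv one_ne_zero).clm_comp continuous_const
  have hzero : ∀ x, ∀ v ∉ K, fderiv ℝ (F · v) x = 0 := by
    intro x v hv
    have : (F · v) = fun _ => 0 := funext fun y => hFK y v hv
    rw [this]
    simp
  have hint : ∀ x, Integrable (fun v => F x v) μ := fun x =>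
    (hF.continuous.comp (Continuous.prodMk_right x)).integrable_of_hasCompactSupport
      (HasCompactSupport.intro hK (hFK x))
  have hint' : Integrable (fun v => fderiv ℝ (F · v) x₀) μ :=
    (hcont.comp (Continuous.prodMk_right x₀)).integrable_of_hasCompactSupport
      (HasCompactSupport.intro hK (hzero x₀))
  obtain ⟨C, hC⟩ := ((isCompact_closedBall x₀ 1).prod hK).exists_bound_of_continuousOn
    hcont.continuousOn
  refine ⟨hint', hasFDerivAt_integral_of_dominated_of_fderiv_le
    (F' := fun x v => fderiv ℝ (F · v) x) (bound := K.indicator fun _ => C)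
    (Metric.closedBall_mem_nhds x₀ one_pos) (.of_forall fun x => (hint x).aestronglyMeasurable)
    (hint x₀) hint'.aestronglyMeasurable (.of_forall fun v x hx => ?_) ?_
    (.of_forall fun v x _ => (hd x v).differentiableAt.hasFDerivAt)⟩
  · by_cases hv : v ∈ K
    · simpa [hv] using hC (x, v) ⟨hx, hv⟩
    · simp [hv, hzero x v hv]
  · rw [integrable_indicator_iff hK.measurableSet]
    exact integrableOn_const hK.measure_lt_top.ne

/-- The derivative of `w` in the coordinate directions. -/
def wDir : Fin 4 → ℂ := ![0, 1, 0, I]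

/-- The derivative of `z` in the coordinate directions. -/
def zDir : Fin 4 → ℂ := ![1, 0, I, 0]

theorem wOf_add_smul_single (x : R4) (i : Fin 4) (s : ℝ) :
    wOf (x + s • Pi.single i 1) = wOf x + s * wDir i := by
  fin_cases i <;> simp [wOf, wDir] <;> ring

theorem zOf_add_smul_single (x : R4) (i : Fin 4) (s : ℝ) :
    zOf (x + s • Pi.single i 1) = zOf x + s * zDir i := by
  fin_cases i <;> simp [zOf, zDir] <;> ring

theorem contDiff_wOf {n : WithTop ℕ∞} : ContDiff ℝ n wOf := by
  unfold wOf
  have h (i : Fin 4) : ContDiff ℝ n (fun x : R4 => (x i : ℂ)) :=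
    ofRealCLM.contDiff.comp (contDiff_apply ℝ ℝ i)
  exact (h 1).add (contDiff_const.mul (h 3))

theorem contDiff_zOf {n : WithTop ℕ∞} : ContDiff ℝ n zOf := by
  unfold zOf
  have h (i : Fin 4) : ContDiff ℝ n (fun x : R4 => (x i : ℂ)) :=
    ofRealCLM.contDiff.comp (contDiff_apply ℝ ℝ i)
  exact (h 0).add (contDiff_const.mul (h 2))

theorem pd4_eq_of_hasDerivAt {u : R4 → ℂ} {x : R4} {i : Fin 4} {c : ℂ}
    (hu : DifferentiableAt ℝ u x)
    (h : HasDerivAt (fun s : ℝ => u (x + s • Pi.single i 1)) c 0) : pd4 i u x = c := by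
  rw [pd4, ← hu.lineDeriv_eq_fderiv]
  exact h.deriv

/-- The function `b e^w + c e^{w̄}` on `ℝ⁴`. -/
def expSum (b c : ℂ) : R4 → ℂ := fun x =>
  b * Complex.exp (wOf x) + c * Complex.exp (conj (wOf x))

theorem contDiff_expSum (b c : ℂ) {n : WithTop ℕ∞} : ContDiff ℝ n (expSum b c) := by
  unfold expSum
  exact (contDiff_const.mul contDiff_wOf.cexp).add
    (contDiff_const.mul (conjCLE.contDiff.comp contDiff_wOf).cexp)

theorem hasDerivAt_expSum_line (b c : ℂ) (x : R4) (i : Fin 4) :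
    HasDerivAt (fun s : ℝ => expSum b c (x + s • Pi.single i 1))
      (expSum (b * wDir i) (c * conj (wDir i)) x) 0 := by
  have h (a d : ℂ) : HasDerivAt (fun s : ℝ => Complex.exp (a + s * d)) (Complex.exp a * d) 0 := by
    have h1 : HasDerivAt (fun s : ℝ => a + (s : ℂ) * d) (1 * d) 0 :=
      (((hasDerivAt_id (0 : ℝ)).ofReal_comp).mul_const d).const_add a
    simpa using h1.cexp
  have := ((h (wOf x) (wDir i)).const_mul b).add
    ((h (conj (wOf x)) (conj (wDir i))).const_mul c)
  simp only [expSum, wOf_add_smul_single, map_add, map_mul, conj_ofReal]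
  convert! this using 1
  ring

theorem pd4_expSum (b c : ℂ) (i : Fin 4) :
    pd4 i (expSum b c) = expSum (b * wDir i) (c * conj (wDir i)) :=
  funext fun x => pd4_eq_of_hasDerivAt
    ((contDiff_expSum b c (n := 1)).differentiable one_ne_zero x) (hasDerivAt_expSum_line b c x i)

theorem pd4Multi_expSum (r : ℕ) (idx : Fin r → Fin 4) (b c : ℂ) :
    pd4Multi r idx (expSum b c) =
      expSum (b * ∏ k, wDir (idx k)) (c * ∏ k, conj (wDir (idx k))) := by
  induction r generalizing b c with
  | zero => simp [pd4Multi]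
  | succ r ih => rw [pd4Multi, pd4_expSum, ih, Fin.prod_univ_succ, Fin.prod_univ_succ,
      mul_assoc, mul_assoc]

theorem pd4_affHamC4 (A : ℂ × ℂ) (i : Fin 4) :
    pd4 i (affHamC4 A) = fun x => (1 / 2) * (A.1 * zDir i + conj A.1 * conj (zDir i)) +
      expSum (A.2 / 2 * wDir i) (conj A.2 / 2 * conj (wDir i)) x := by
  have hA : affHamC4 A = fun x => (1 / 2) * (A.1 * zOf x + conj A.1 * conj (zOf x)) +
      expSum (A.2 / 2) (conj A.2 / 2) x := by
    ext x
    simp only [affHamC4, expSum]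
    ring
  ext x
  rw [hA]
  apply pd4_eq_of_hasDerivAt
  · have h1 : ContDiff ℝ 1 fun x => (1 / 2) * (A.1 * zOf x + conj A.1 * conj (zOf x)) :=
      contDiff_const.mul ((contDiff_const.mul contDiff_zOf).add
        (contDiff_const.mul (conjCLE.contDiff.comp contDiff_zOf)))
    exact (h1.add (contDiff_expSum _ _)).differentiable one_ne_zero x
  · refine HasDerivAt.add ?_ (hasDerivAt_expSum_line _ _ x i)
    have h (a d : ℂ) : HasDerivAt (fun s : ℝ => a + (s : ℂ) * d) d 0 := by
      simpa using (((hasDerivAt_id (0 : ℝ)).ofReal_comp).mul_const d).const_add a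
    simp only [zOf_add_smul_single, map_add, map_mul, conj_ofReal]
    exact (((h _ _).const_mul _).add ((h _ _).const_mul _)).const_mul _

theorem pd4_const_add (i : Fin 4) (c : ℂ) (u : R4 → ℂ) : pd4 i (fun x => c + u x) = pd4 i u := by
  ext x
  simp [pd4, fderiv_const_add]

theorem pd4Multi_affHamC4 (A : ℂ × ℂ) {r : ℕ} (hr : 2 ≤ r) (idx : Fin r → Fin 4) :
    pd4Multi r idx (affHamC4 A) =
      expSum (A.2 / 2 * ∏ k, wDir (idx k)) (conj A.2 / 2 * ∏ k, conj (wDir (idx k))) := by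
  obtain ⟨n, rfl⟩ := Nat.exists_eq_add_of_le' hr
  rw [pd4Multi, pd4Multi, pd4_affHamC4, pd4_const_add, pd4_expSum, pd4Multi_expSum]
  simp only [Fin.prod_univ_succ, mul_assoc]

/-- The real frequency conjugate to the `i`-th coordinate under `F_z`
(set to zero for the `q` coordinates). -/
def momentum : Fin 4 → ℂ → ℂ := ![fun ξ => ξ.re, 0, fun ξ => ξ.im, 0]

theorem contDiff_momentum (i : Fin 4) {n : WithTop ℕ∞} : ContDiff ℝ n (momentum i) := by
  have h1 : ContDiff ℝ n (fun ξ : ℂ => (ξ.re : ℂ)) := ofRealCLM.contDiff.comp reCLM.contDiff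
  have h2 : ContDiff ℝ n (fun ξ : ℂ => (ξ.im : ℂ)) := ofRealCLM.contDiff.comp imCLM.contDiff
  fin_cases i
  · exact h1
  · exact contDiff_const
  · exact h2
  · exact contDiff_const

theorem pd4_toCoords_FzInv {f : ℂ × ℂ → ℂ} (hf : ContDiff ℝ (⊤ : ℕ∞) f)
    (hs : HasCompactSupport f) {i : Fin 4} (hi : wDir i = 0) :
    pd4 i (toCoords (FzInv f)) = toCoords (FzInv fun p => I * momentum i p.1 * f p) := by
  set F : R4 → ℝ × ℝ → ℂ := fun x t =>
    Complex.exp (I * (((((t.1 : ℂ) + I * (t.2 : ℂ)) * conj (zOf x)).re : ℂ))) *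
      f ((t.1 : ℂ) + I * (t.2 : ℂ), wOf x) with hFdef
  have hv : ContDiff ℝ 1 (fun q : R4 × ℝ × ℝ => (q.2.1 : ℂ) + I * (q.2.2 : ℂ)) :=
    (ofRealCLM.contDiff.comp (contDiff_fst.comp contDiff_snd)).add
      (contDiff_const.mul (ofRealCLM.contDiff.comp (contDiff_snd.comp contDiff_snd)))
  have hF : ContDiff ℝ 1 (Function.uncurry F) := by
    refine ContDiff.mul (ContDiff.cexp (contDiff_const.mul ?_)) ?_
    · exact ofRealCLM.contDiff.comp (reCLM.contDiff.comp (hv.mul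
        (conjCLE.contDiff.comp (contDiff_zOf.comp contDiff_fst))))
    · exact (hf.of_le (by exact_mod_cast le_top)).comp
        (hv.prodMk (contDiff_wOf.comp contDiff_fst))
  set K : Set (ℝ × ℝ) := Set.image (fun p : ℂ × ℂ => (p.1.re, p.1.im)) (tsupport f)
  have hK : IsCompact K := hs.isCompact.image (by fun_prop)
  have hFK : ∀ x, ∀ t ∉ K, F x t = 0 := by
    intro x t ht
    have : f ((t.1 : ℂ) + I * (t.2 : ℂ), wOf x) = 0 := by
      by_contra h
      exact ht ⟨_, subset_tsupport f h, by simp⟩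
    simp [hFdef, this]
  ext x
  obtain ⟨hint, hderiv⟩ := hasFDerivAt_integral_of_contDiff_of_isCompact (μ := volume) hF hK hFK x
  have hline : ∀ t, fderiv ℝ (F · t) x (Pi.single i 1) =
      I * momentum i ((t.1 : ℂ) + I * (t.2 : ℂ)) * F x t := by
    intro t
    change pd4 i (F · t) x = _
    apply pd4_eq_of_hasDerivAt
    · exact (hF.comp (contDiff_id.prodMk contDiff_const)).differentiable one_ne_zero x
    · have h1 : ∀ s : ℝ, F (x + s • Pi.single i 1) t =
          Complex.exp (I * ((((t.1 : ℂ) + I * (t.2 : ℂ)) * conj (zOf x)).re : ℂ) +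
            s * (I * momentum i ((t.1 : ℂ) + I * (t.2 : ℂ)))) *
          f ((t.1 : ℂ) + I * (t.2 : ℂ), wOf x) := by
        intro s
        simp only [hFdef, wOf_add_smul_single, zOf_add_smul_single, hi, mul_zero, add_zero]
        congr 2
        fin_cases i <;> simp [momentum, zDir, wDir] at hi ⊢ <;> ring
      simp only [h1]
      have h2 : HasDerivAt (fun s : ℝ => I * ((((t.1 : ℂ) + I * (t.2 : ℂ)) * conj (zOf x)).re : ℂ) +
            (s : ℂ) * (I * momentum i ((t.1 : ℂ) + I * (t.2 : ℂ))))
            (1 * (I * momentum i ((t.1 : ℂ) + I * (t.2 : ℂ)))) 0 :=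
        (((hasDerivAt_id (0 : ℝ)).ofReal_comp).mul_const _).const_add _
      convert! h2.cexp.mul_const (f ((t.1 : ℂ) + I * (t.2 : ℂ), wOf x)) using 1
      simp [hFdef]
      ring
  have heq : toCoords (FzInv f) = (1 / (2 * Real.pi) : ℝ) • fun x => ∫ t, F x t := rfl
  rw [pd4, heq, (hderiv.const_smul _).fderiv, smul_apply,
    ContinuousLinearMap.integral_apply hint]
  simp only [hline]
  simp only [toCoords, FzInv, hFdef]
  congr 2
  ext t
  ring

theorem pd4Multi_toCoords_FzInv (r : ℕ) (idx : Fin r → Fin 4) (hidx : ∀ k, wDir (idx k) = 0)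
    {f : ℂ × ℂ → ℂ} (hf : ContDiff ℝ (⊤ : ℕ∞) f) (hs : HasCompactSupport f) :
    pd4Multi r idx (toCoords (FzInv f)) =
      toCoords (FzInv fun p => (∏ k, I * momentum (idx k) p.1) * f p) := by
  induction r generalizing f with
  | zero => simp [pd4Multi]
  | succ r ih =>
    rw [pd4Multi, pd4_toCoords_FzInv hf hs (hidx 0), ih _ fun k => hidx k.succ]
    · simp only [Fin.prod_univ_succ]
      congr 2
      ext p
      ring
    · exact (contDiff_const.mul ((contDiff_momentum _).comp contDiff_fst)).mul hf
    · exact hs.mul_left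

theorem integral_real_prod_eq_integral_complex (G : ℂ → ℂ) :
    ∫ t : ℝ × ℝ, G ((t.1 : ℂ) + I * (t.2 : ℂ)) = ∫ v : ℂ, G v := by
  rw [← volume_preserving_equiv_real_prod.symm.integral_comp
    measurableEquivRealProd.symm.measurableEmbedding G]
  refine integral_congr_ae (.of_forall fun t => ?_)
  change G (t.1 + I * t.2) = G (measurableEquivRealProd.symm t)
  rw [measurableEquivRealProd_symm_apply, mk_eq_add_mul_I, mul_comm I]

theorem FzInv_eq_fourierInv (h : ℂ × ℂ → ℂ) (z w : ℂ) :
    FzInv h (z, w) = (1 / (2 * Real.pi) : ℝ) •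
      𝓕⁻ (fun v => h (v, w)) ((2 * Real.pi)⁻¹ • z) := by
  rw [Real.fourierInv_eq', ← integral_real_prod_eq_integral_complex]
  simp only [FzInv, smul_eq_mul]
  congr 2
  ext t
  congr 2
  rw [inner_smul_right, Complex.inner, mul_inv_cancel_left₀ (by positivity), mul_comm I]
  congr 2
  simp [mul_comm]

theorem Fz_eq_fourier (u : ℂ × ℂ → ℂ) (ξ w : ℂ) :
    Fz u (ξ, w) = (2 * Real.pi : ℝ) • 𝓕 (fun z => u ((2 * Real.pi : ℝ) • z, w)) ξ := by
  have h := Measure.integral_comp_smul_of_nonneg (volume : Measure ℂ)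
    (fun z => Complex.exp (-(I * ((ξ * conj z).re : ℂ))) * u (z, w)) (2 * Real.pi)
    (hR := by positivity)
  have h2 : 𝓕 (fun z => u ((2 * Real.pi : ℝ) • z, w)) ξ =
      ∫ z : ℂ, Complex.exp (-(I * ((ξ * conj ((2 * Real.pi : ℝ) • z)).re : ℂ))) *
        u ((2 * Real.pi : ℝ) • z, w) := by
    rw [Real.fourier_eq']
    congr 1
    ext z
    rw [smul_eq_mul]
    congr 2
    simp [Complex.inner]
    ring
  rw [h2, h, finrank_real_complex, smul_smul, Fz, integral_real_prod_eq_integral_complex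
    (fun z => Complex.exp (-(I * ((ξ * conj z).re : ℂ))) * u (z, w))]
  congr 1
  field_simp

theorem HasCompactSupport.slice {f : ℂ × ℂ → ℂ} (hs : HasCompactSupport f) (w : ℂ) :
    HasCompactSupport fun v => f (v, w) := by
  refine HasCompactSupport.intro (hs.isCompact.image continuous_fst) fun v hv => ?_
  by_contra h
  exact hv ⟨_, subset_tsupport f h, rfl⟩

/-- Fourier inversion for the partial Fourier transform. -/
theorem Fz_FzInv {h : ℂ × ℂ → ℂ} (hh : ContDiff ℝ (⊤ : ℕ∞) h) (hs : HasCompactSupport h) :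
    Fz (FzInv h) = h := by
  ext ⟨ξ, w⟩
  set φ : SchwartzMap ℂ ℂ := (hs.slice w).toSchwartzMap
    (hh.comp (contDiff_id.prodMk contDiff_const)) with hφ
  have hφ' : (fun v => h (v, w)) = φ := rfl
  have hπ : (2 * Real.pi) ≠ 0 := by positivity
  rw [Fz_eq_fourier]
  simp only [FzInv_eq_fourierInv, smul_smul, inv_mul_cancel₀ hπ, one_smul, hφ']
  have h1 : (fun z => (1 / (2 * Real.pi)) • 𝓕⁻ (φ : ℂ → ℂ) z) =
      ((1 / (2 * Real.pi) : ℝ) • 𝓕⁻ φ : SchwartzMap ℂ ℂ) := by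
    ext z
    simp [SchwartzMap.fourierInv_coe]
  rw [h1, ← SchwartzMap.fourier_coe, FourierTransform.fourier_smul,
    FourierTransform.fourier_fourierInv_eq, smul_apply, smul_smul,
    mul_one_div_cancel hπ, one_smul]
  rfl

theorem sum_prod_eq_pow {ι R : Type*} [Fintype ι] [CommRing R] (r : ℕ) (c : ι → ι → R) :
    ∑ i : Fin r → ι, ∑ j : Fin r → ι, ∏ k, c (i k) (j k) = (∑ a, ∑ b, c a b) ^ r := by
  classical
  have h := Finset.prod_univ_sum (fun _ : Fin r => (Finset.univ : Finset (ι × ι)))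
    (fun _ p => c p.1 p.2)
  rw [Finset.prod_const, Finset.card_univ, Fintype.card_fin, Fintype.sum_prod_type] at h
  rw [h, Fintype.piFinset_univ, ← Fintype.sum_prod_type',
    ← (Equiv.arrowProdEquivProdArrow (Fin r) (fun _ => ι) (fun _ => ι)).sum_comp]
  rfl

theorem lambda4_mul_wDir_eq_zero {a b : Fin 4} (hb : wDir b ≠ 0) : lambda4 a b * wDir a = 0 := by
  fin_cases a <;> fin_cases b <;> simp [lambda4, wDir] at hb ⊢

theorem integrable_FzInv_integrand {h : ℂ × ℂ → ℂ} (hh : Continuous h) (hs : HasCompactSupport h)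
    (z w : ℂ) : Integrable fun t : ℝ × ℝ =>
      Complex.exp (I * (((((t.1 : ℂ) + I * (t.2 : ℂ)) * conj z).re : ℂ))) *
        h ((t.1 : ℂ) + I * (t.2 : ℂ), w) := by
  refine Continuous.integrable_of_hasCompactSupport (by fun_prop) (HasCompactSupport.mul_left ?_)
  refine HasCompactSupport.intro ((hs.slice w).isCompact.image
    (f := fun v : ℂ => (v.re, v.im)) (by fun_prop)) fun t ht => ?_
  by_contra hne
  exact ht ⟨_, subset_tsupport (fun v => h (v, w)) hne, by simp⟩

theorem FzInv_sum {ι : Type*} [Fintype ι] {h : ι → ℂ × ℂ → ℂ} (hh : ∀ s, Continuous (h s))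
    (hs : ∀ s, HasCompactSupport (h s)) :
    FzInv (fun p => ∑ s, h s p) = ∑ s, FzInv (h s) := by
  ext ⟨z, w⟩
  simp only [Finset.sum_apply, FzInv, Finset.mul_sum]
  rw [integral_finsetSum _ fun s _ => integrable_FzInv_integrand (hh s) (hs s) z w,
    Finset.smul_sum]

theorem FzInv_mul_left (c : ℂ → ℂ) (h : ℂ × ℂ → ℂ) (z w : ℂ) :
    FzInv (fun p => c p.2 * h p) (z, w) = c w * FzInv h (z, w) := by
  simp only [FzInv, mul_left_comm _ (c w), integral_const_mul, mul_smul_comm]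

theorem ofCoords_toCoords (h : ℂ × ℂ → ℂ) : ofCoords (toCoords h) = h := by
  ext ⟨z, w⟩
  simp only [ofCoords, toCoords, zOf, wOf]
  congr 2 <;> simp [mul_comm I]

/-- The `F_z`-symbol of the `(i, j)` summand of `P^r(Ã, F_z⁻¹(f))`. -/
def symbolTerm (A : ℂ × ℂ) {r : ℕ} (i j : Fin r → Fin 4) (f : ℂ × ℂ → ℂ) : ℂ × ℂ → ℂ := fun p =>
  ((∏ k, lambda4 (i k) (j k)) *
    (A.2 / 2 * (∏ k, wDir (i k)) * Complex.exp p.2 +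
      conj A.2 / 2 * (∏ k, conj (wDir (i k))) * Complex.exp (conj p.2))) *
  ((∏ k, I * momentum (j k) p.1) * f p)

theorem contDiff_symbolTerm (A : ℂ × ℂ) {r : ℕ} (i j : Fin r → Fin 4) {f : ℂ × ℂ → ℂ}
    (hf : ContDiff ℝ (⊤ : ℕ∞) f) : ContDiff ℝ (⊤ : ℕ∞) (symbolTerm A i j f) := by
  refine ContDiff.mul (contDiff_const.mul (ContDiff.add ?_ ?_)) (ContDiff.mul ?_ hf)
  · exact contDiff_const.mul contDiff_snd.cexp
  · exact contDiff_const.mul (conjCLE.contDiff.comp contDiff_snd).cexp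
  · exact contDiff_prod fun k _ => contDiff_const.mul ((contDiff_momentum _).comp contDiff_fst)

theorem hasCompactSupport_symbolTerm (A : ℂ × ℂ) {r : ℕ} (i j : Fin r → Fin 4) {f : ℂ × ℂ → ℂ}
    (hs : HasCompactSupport f) : HasCompactSupport (symbolTerm A i j f) :=
  hs.mul_left.mul_left

theorem P4_affHamC4_term (A : ℂ × ℂ) {f : ℂ × ℂ → ℂ} (hf : ContDiff ℝ (⊤ : ℕ∞) f)
    (hs : HasCompactSupport f) {r : ℕ} (hr : 2 ≤ r) (i j : Fin r → Fin 4) (x : R4) :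
    (∏ k, lambda4 (i k) (j k)) * pd4Multi r i (affHamC4 A) x *
      pd4Multi r j (toCoords (FzInv f)) x = toCoords (FzInv (symbolTerm A i j f)) x := by
  have hsymb := FzInv_mul_left (fun w => (∏ k, lambda4 (i k) (j k)) *
      (A.2 / 2 * (∏ k, wDir (i k)) * Complex.exp w +
        conj A.2 / 2 * (∏ k, conj (wDir (i k))) * Complex.exp (conj w)))
      (fun p => (∏ k, I * momentum (j k) p.1) * f p) (zOf x) (wOf x)
  rw [pd4Multi_affHamC4 A hr]
  change _ = FzInv (symbolTerm A i j f) (zOf x, wOf x)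
  unfold symbolTerm
  rw [hsymb]
  change (_ * expSum _ _ x) * _ = (_ * expSum _ _ x) * _
  by_cases hj : ∀ k, wDir (j k) = 0
  · rw [pd4Multi_toCoords_FzInv r j hj hf hs]
    rfl
  · push Not at hj
    obtain ⟨k, hk⟩ := hj
    have hzero : (∏ k, lambda4 (i k) (j k)) * ∏ k, wDir (i k) = 0 := by
      rw [← Finset.prod_mul_distrib]
      exact Finset.prod_eq_zero (Finset.mem_univ k) (lambda4_mul_wDir_eq_zero hk)
    rcases mul_eq_zero.mp hzero with h | h
    · simp [h]
    · simp [expSum, ← map_prod, h]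

theorem sum_symbolTerm (A : ℂ × ℂ) {r : ℕ} (hr : 2 ≤ r) (f : ℂ × ℂ → ℂ) (ξ w : ℂ) :
    ∑ s : (Fin r → Fin 4) × (Fin r → Fin 4), symbolTerm A s.1 s.2 f (ξ, w) =
      (-1 : ℂ) ^ r * 2 ^ (r - 1) *
        (conj A.2 * Complex.exp (conj w) * (I * ξ / 2) ^ r +
          A.2 * Complex.exp w * (I * conj ξ / 2) ^ r) * f (ξ, w) := by
  have h1 := sum_prod_eq_pow r
    (fun a b => lambda4 a b * wDir a * (I * momentum b ξ))
  have h2 := sum_prod_eq_pow r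
    (fun a b => lambda4 a b * conj (wDir a) * (I * momentum b ξ))
  have e1 : ∑ a, ∑ b, lambda4 a b * wDir a * (I * momentum b ξ) = -(I * conj ξ) := by
    simp [Fin.sum_univ_four, lambda4, wDir, momentum]
    apply Complex.ext <;> simp
  have e2 : ∑ a, ∑ b, lambda4 a b * conj (wDir a) * (I * momentum b ξ) = -(I * ξ) := by
    simp [Fin.sum_univ_four, lambda4, wDir, momentum]
    apply Complex.ext <;> simp
  rw [e1] at h1
  rw [e2] at h2
  have hsplit : ∀ i j : Fin r → Fin 4, symbolTerm A i j f (ξ, w) =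
      A.2 / 2 * Complex.exp w * f (ξ, w) *
        (∏ k, lambda4 (i k) (j k) * wDir (i k) * (I * momentum (j k) ξ)) +
      conj A.2 / 2 * Complex.exp (conj w) * f (ξ, w) *
        (∏ k, lambda4 (i k) (j k) * conj (wDir (i k)) * (I * momentum (j k) ξ)) := by
    intro i j
    simp only [symbolTerm, Finset.prod_mul_distrib]
    ring
  rw [Fintype.sum_prod_type]
  simp only [hsplit, Finset.sum_add_distrib, ← Finset.mul_sum]
  rw [h1, h2]
  obtain ⟨n, rfl⟩ := Nat.exists_eq_add_of_le' hr
  rw [neg_pow (I * conj ξ), neg_pow (I * ξ), div_pow, div_pow, show n + 2 - 1 = n + 1 from rfl,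
    pow_succ (2 : ℂ) (n + 1)]
  field_simp
  ring

end Auxiliary

/-- For `A = (α,β) ∈ aff(ℂ)` with Hamiltonian
`Ã(z,w) = (1/2)(αz + βe^w + ᾱz̄ + β̄e^{w̄})`, a compactly supported smooth
function `f` of `(ξ,w) ∈ ℂ × ℂ`, and `g = F_z⁻¹(f)`: for every `r ≥ 2`,
`F_z(P^r(Ã,g))(ξ,w) = (-1)^r 2^{r-1} [β̄e^{w̄}(iξ/2)^r + βe^w(iξ̄/2)^r] f(ξ,w)`. -/
theorem Fz_P_of_affine_hamiltonian (A : ℂ × ℂ) (f : ℂ × ℂ → ℂ)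
    (hsmooth : ContDiff ℝ (⊤ : ℕ∞) f) (hsupp : HasCompactSupport f) :
    ∀ r : ℕ, 2 ≤ r → ∀ ξ w : ℂ,
      Fz (ofCoords (P4 r (affHamC4 A) (toCoords (FzInv f)))) (ξ, w) =
        (-1 : ℂ) ^ r * 2 ^ (r - 1) *
          ((starRingEnd ℂ) A.2 * Complex.exp ((starRingEnd ℂ) w) * (I * ξ / 2) ^ r +
            A.2 * Complex.exp w * (I * (starRingEnd ℂ) ξ / 2) ^ r) * f (ξ, w) := by
  intro r hr ξ w
  have hsum : P4 r (affHamC4 A) (toCoords (FzInv f)) = toCoords (FzInv fun p =>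
      ∑ s : (Fin r → Fin 4) × (Fin r → Fin 4), symbolTerm A s.1 s.2 f p) := by
    ext x
    rw [FzInv_sum (h := fun s : (Fin r → Fin 4) × (Fin r → Fin 4) => symbolTerm A s.1 s.2 f)
      (fun s => (contDiff_symbolTerm A s.1 s.2 hsmooth).continuous)
      fun s => hasCompactSupport_symbolTerm A s.1 s.2 hsupp]
    simp only [P4, P4_affHamC4_term A hsmooth hsupp hr, toCoords, Finset.sum_apply,
      Fintype.sum_prod_type]
  have hsmooth_sum : ContDiff ℝ (⊤ : ℕ∞) fun p =>
      ∑ s : (Fin r → Fin 4) × (Fin r → Fin 4), symbolTerm A s.1 s.2 f p :=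
    ContDiff.sum fun s _ => contDiff_symbolTerm A s.1 s.2 hsmooth
  have hsupp_sum : HasCompactSupport fun p =>
      ∑ s : (Fin r → Fin 4) × (Fin r → Fin 4), symbolTerm A s.1 s.2 f p := by
    refine HasCompactSupport.intro hsupp fun p hp => Finset.sum_eq_zero fun s _ => ?_
    simp [symbolTerm, image_eq_zero_of_notMem_tsupport hp]
  rw [hsum, ofCoords_toCoords, Fz_FzInv hsmooth_sum hsupp_sum]
  exact sum_symbolTerm A hr f ξ w

end
end

section
/- For A = (α,β) ∈ aff(C), define on C^∞(C,C) (smooth complex-valued functions of the complex variable u) the operator ℓ̂_A := α∂_u + ᾱ∂_ū + (i/2)(βe^u + β̄e^{ū}), where ∂_u, ∂_ū are the Wirtinger derivatives and βe^u + β̄e^{ū} acts by multiplication. Then A ↦ ℓ̂_A is a representation of the Lie algebra aff(C): for all A = (α,β), B = (α',β'), ℓ̂_A ∘ ℓ̂_B − ℓ̂_B ∘ ℓ̂_A = ℓ̂_{[A,B]} with [A,B] = (0, αβ' − α'β). -/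
noncomputable section

open Complex

/-- The Wirtinger derivative `∂_u f` of `f : ℂ → ℂ`, `u = u₁ + iu₂`,
`∂_u = (1/2)(∂_{u₁} - i∂_{u₂})`. -/
def wdU (f : ℂ → ℂ) : ℂ → ℂ := fun u =>
  (1 / 2) * (fderiv ℝ f u 1 - I * fderiv ℝ f u I)

/-- The Wirtinger derivative `∂_ū f` of `f : ℂ → ℂ`,
`∂_ū = (1/2)(∂_{u₁} + i∂_{u₂})`. -/
def wdUbar (f : ℂ → ℂ) : ℂ → ℂ := fun u =>
  (1 / 2) * (fderiv ℝ f u 1 + I * fderiv ℝ f u I)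

/-- The operator `ℓ̂_A = α∂_u + ᾱ∂_ū + (i/2)(βe^u + β̄e^{ū})` on smooth functions
of the complex variable `u`, for `A = (α,β) ∈ aff(ℂ)`. -/
def lhat (A : ℂ × ℂ) (f : ℂ → ℂ) : ℂ → ℂ := fun u =>
  A.1 * wdU f u + (starRingEnd ℂ) A.1 * wdUbar f u +
    (I / 2) * (A.2 * Complex.exp u +
      (starRingEnd ℂ) A.2 * Complex.exp ((starRingEnd ℂ) u)) * f u

/-- Multiplier of the operator `ℓ̂_A`, as a function of `β` and `u`. -/
def lhatMultiplier (b u : ℂ) : ℂ :=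
  (I / 2) * (b * Complex.exp u + (starRingEnd ℂ) b * Complex.exp ((starRingEnd ℂ) u))

/-- The first order part of `ℓ̂_A` is the real directional derivative along `α`. -/
theorem lhat_eq_fderiv_add (A : ℂ × ℂ) (f : ℂ → ℂ) (u : ℂ) :
    lhat A f u = fderiv ℝ f u A.1 + lhatMultiplier A.2 u * f u := by
  have h : fderiv ℝ f u A.1 = A.1.re * fderiv ℝ f u 1 + A.1.im * fderiv ℝ f u I := by
    conv_lhs => rw [show A.1 = A.1.re • (1 : ℂ) + A.1.im • I by simp [Complex.re_add_im]]
    rw [map_add, map_smul, map_smul, Complex.real_smul, Complex.real_smul]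
  have hconj : (starRingEnd ℂ) A.1 = A.1.re - A.1.im * I := by
    apply Complex.ext <;> simp
  have hA : A.1 = A.1.re + A.1.im * I := (Complex.re_add_im _).symm
  simp only [lhat, wdU, wdUbar, lhatMultiplier, h, hconj]
  linear_combination (1 / 2) * (fderiv ℝ f u 1 - I * fderiv ℝ f u I) * hA -
    A.1.im * fderiv ℝ f u I * Complex.I_sq

theorem hasFDerivAt_lhatMultiplier (b u : ℂ) :
    ∃ L : ℂ →L[ℝ] ℂ, HasFDerivAt (lhatMultiplier b) L u ∧
      ∀ a, L a = lhatMultiplier (a * b) u := by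
  have h1 : HasFDerivAt Complex.exp
      ((ContinuousLinearMap.toSpanSingleton ℂ (Complex.exp u)).restrictScalars ℝ) u :=
    (Complex.hasDerivAt_exp u).hasFDerivAt.restrictScalars ℝ
  have h2 : HasFDerivAt Complex.exp
      ((ContinuousLinearMap.toSpanSingleton ℂ
        (Complex.exp ((starRingEnd ℂ) u))).restrictScalars ℝ) ((starRingEnd ℂ) u) :=
    (Complex.hasDerivAt_exp _).hasFDerivAt.restrictScalars ℝ
  have h3 : HasFDerivAt (fun v : ℂ => (starRingEnd ℂ) v) (Complex.conjCLE : ℂ →L[ℝ] ℂ) u :=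
    Complex.conjCLE.hasFDerivAt
  refine ⟨_, ((h1.const_mul b).add ((h2.comp u h3).const_mul _)).const_mul (I / 2), fun a => ?_⟩
  simp [lhatMultiplier]
  ring

theorem fderiv_lhat_apply (A : ℂ × ℂ) {f : ℂ → ℂ} (hf : ContDiff ℝ 2 f) (u v : ℂ) :
    fderiv ℝ (lhat A f) u v = fderiv ℝ (fderiv ℝ f) u v A.1 +
      (lhatMultiplier A.2 u * fderiv ℝ f u v + lhatMultiplier (v * A.2) u * f u) := by
  obtain ⟨L, hL, hLa⟩ := hasFDerivAt_lhatMultiplier A.2 u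
  have hd : HasFDerivAt (fderiv ℝ f) (fderiv ℝ (fderiv ℝ f) u) u :=
    ((hf.fderiv_right (m := 1) (by norm_num)).differentiable (by norm_num) u).hasFDerivAt
  have hd' : HasFDerivAt f (fderiv ℝ f u) u := (hf.differentiable (by norm_num) u).hasFDerivAt
  have h := (hd.clm_apply (hasFDerivAt_const A.1 u)).add (hL.mul hd')
  have heq : lhat A f = (fun w => fderiv ℝ f w A.1) + (lhatMultiplier A.2 * f) :=
    funext fun w => lhat_eq_fderiv_add A f w
  rw [heq, h.fderiv]
  simp [hLa]
  ring

/-- `A ↦ ℓ̂_A` is a representation of the Lie algebra `aff(ℂ)`: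
`ℓ̂_A ∘ ℓ̂_B - ℓ̂_B ∘ ℓ̂_A = ℓ̂_{[A,B]}` with `[A,B] = (0, αβ' - α'β)`. -/
theorem lhat_lie_algebra_rep (A B : ℂ × ℂ) (f : ℂ → ℂ) (hf : ContDiff ℝ (⊤ : ℕ∞) f) :
    ∀ u : ℂ,
      lhat A (lhat B f) u - lhat B (lhat A f) u =
        lhat (0, A.1 * B.2 - B.1 * A.2) f u := by
  intro u
  have hf2 : ContDiff ℝ 2 f := contDiff_infty.1 hf 2
  have hsymm : fderiv ℝ (fderiv ℝ f) u A.1 B.1 = fderiv ℝ (fderiv ℝ f) u B.1 A.1 :=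
    (hf2.contDiffAt.isSymmSndFDerivAt (by simp)).eq A.1 B.1
  rw [lhat_eq_fderiv_add A, lhat_eq_fderiv_add B (lhat A f), fderiv_lhat_apply B hf2,
    fderiv_lhat_apply A hf2, lhat_eq_fderiv_add A f, lhat_eq_fderiv_add B f,
    lhat_eq_fderiv_add (0, _), hsymm]
  simp only [lhatMultiplier, map_zero, map_sub, map_mul]
  ring

end
end
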